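/- Let p be an odd prime, let s ∈ ℤ_p with s ≠ 1, and let a ∈ ℚ_p with |a|_p > 1. Then the series Σ_{n=2}^∞ [ (∏_{j=1}^{n−1}(s−1+j)) / (n!·ω_v(a)^n) ]·(ζ_{p,E}(s+n,a) − ⟨a⟩^{1−(s+n)}) converges in ℚ_p. -/

import Mathlib

open Filter Topology

noncomputable def teich (p : ℕ) [Fact p.Prime] (u : ℚ_[p]) : ℚ_[p] :=
  limUnder atTop fun n : ℕ => u ^ p ^ n

noncomputable def omegaV (p : ℕ) [Fact p.Prime] (a : ℚ_[p]) : ℚ_[p] :=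
  (p : ℚ_[p]) ^ a.valuation * teich p (a * (p : ℚ_[p]) ^ (-a.valuation))

noncomputable def proj (p : ℕ) [Fact p.Prime] (a : ℚ_[p]) : ℚ_[p] :=
  a / omegaV p a

noncomputable def binom (p : ℕ) [Fact p.Prime] (s : ℚ_[p]) (n : ℕ) : ℚ_[p] :=
  (∏ j ∈ Finset.range n, (s - (j : ℚ_[p]))) / (n.factorial : ℚ_[p])

noncomputable def hpow (p : ℕ) [Fact p.Prime] (a s : ℚ_[p]) : ℚ_[p] :=
  ∑' n : ℕ, binom p s n * (proj p a - 1) ^ n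

noncomputable def zetaE (p : ℕ) [Fact p.Prime] (s a : ℚ_[p]) : ℚ_[p] :=
  limUnder atTop fun r : ℕ =>
    ∑ k ∈ Finset.range (p ^ r), (-1 : ℚ_[p]) ^ k * hpow p ((k : ℚ_[p]) + a) (1 - s)

noncomputable def coeffT (p : ℕ) [Fact p.Prime] (s a : ℚ_[p]) (n : ℕ) : ℚ_[p] :=
  (∏ j ∈ Finset.Icc 1 (n - 1), (s - 1 + (j : ℚ_[p]))) /
    ((n.factorial : ℚ_[p]) * omegaV p a ^ n)

section Auxiliary

variable {p : ℕ} [Fact p.Prime]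

/-- Limits of sequences in the unit ball are uniformly bounded; the bound also covers the default
value that `limUnder` takes on a divergent sequence. -/
lemma exists_forall_norm_limUnder_le :
    ∃ C : ℝ, ∀ f : ℕ → ℚ_[p], (∀ n, ‖f n‖ ≤ 1) → ‖limUnder atTop f‖ ≤ C := by
  refine ⟨max 1 ‖Classical.epsilon (fun _ : ℚ_[p] => False)‖, fun f hf => ?_⟩
  by_cases h : ∃ x, Tendsto f atTop (𝓝 x)
  · exact le_max_of_le_left
      (le_of_tendsto (tendsto_nhds_limUnder h).norm (Eventually.of_forall hf))
  · have hfalse : (fun x : ℚ_[p] => map f atTop ≤ 𝓝 x) = fun _ => False := by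
      funext x
      exact eq_false fun hx => h ⟨x, hx⟩
    refine le_max_of_le_right (le_of_eq ?_)
    unfold limUnder lim
    rw [hfalse]

lemma PadicInt.dvd_pow_sub_self (x : ℤ_[p]) : (p : ℤ_[p]) ∣ x ^ p - x := by
  rw [← PadicInt.norm_lt_one_iff_dvd, ← PadicInt.mem_nonunits, ← IsLocalRing.mem_maximalIdeal,
    ← PadicInt.ker_toZMod, RingHom.mem_ker, map_sub, map_pow, ZMod.pow_card, sub_self]

lemma Padic.exists_tendsto_pow_prime_pow {u : ℚ_[p]} (hu : ‖u‖ ≤ 1) :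
    ∃ x, Tendsto (fun n : ℕ => u ^ p ^ n) atTop (𝓝 x) := by
  have hp : (p : ℝ)⁻¹ < 1 := inv_lt_one_of_one_lt₀ (mod_cast (Fact.out : p.Prime).one_lt)
  refine cauchySeq_tendsto_of_complete (cauchySeq_of_le_geometric (p : ℝ)⁻¹ 1 hp fun n => ?_)
  let x : ℤ_[p] := ⟨u, hu⟩
  obtain ⟨c, hc⟩ := dvd_sub_pow_of_dvd_sub (PadicInt.dvd_pow_sub_self x) n
  have key : u ^ p ^ (n + 1) - u ^ p ^ n = (p : ℚ_[p]) ^ (n + 1) * (c : ℚ_[p]) := by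
    have := congrArg (fun z : ℤ_[p] => (z : ℚ_[p])) hc
    simp only [PadicInt.coe_sub, PadicInt.coe_pow, PadicInt.coe_mul, PadicInt.coe_natCast] at this
    rw [← this, ← pow_mul, pow_succ']
  rw [dist_comm, dist_eq_norm, key, norm_mul, norm_pow, Padic.norm_p, one_mul]
  calc (p : ℝ)⁻¹ ^ (n + 1) * ‖(c : ℚ_[p])‖ ≤ (p : ℝ)⁻¹ ^ (n + 1) * 1 := by
        gcongr
        exact c.2
    _ ≤ (p : ℝ)⁻¹ ^ n := by
        rw [mul_one]
        exact pow_le_pow_of_le_one (by positivity) hp.le n.le_succ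

lemma norm_teich {u : ℚ_[p]} (hu : ‖u‖ = 1) : ‖teich p u‖ = 1 := by
  refine tendsto_nhds_unique
    (tendsto_nhds_limUnder (Padic.exists_tendsto_pow_prime_pow hu.le)).norm ?_
  simp [hu]

lemma norm_omegaV {a : ℚ_[p]} (ha : a ≠ 0) : ‖omegaV p a‖ = ‖a‖ := by
  have hp : (p : ℝ) ≠ 0 := mod_cast (Fact.out : p.Prime).ne_zero
  have hval := Padic.norm_eq_zpow_neg_valuation ha
  have hunit : ‖a * (p : ℚ_[p]) ^ (-a.valuation)‖ = 1 := by
    rw [norm_mul, hval, Padic.norm_p_zpow, ← zpow_add₀ hp]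
    simp
  rw [omegaV, norm_mul, norm_teich hunit, Padic.norm_p_zpow, mul_one, hval]

lemma Padic.norm_sub_le_max (x y : ℚ_[p]) : ‖x - y‖ ≤ max ‖x‖ ‖y‖ := by
  simpa [sub_eq_add_neg] using Padic.nonarchimedean x (-y)

lemma norm_proj_sub_one_le (a : ℚ_[p]) : ‖proj p a - 1‖ ≤ 1 := by
  rcases eq_or_ne a 0 with rfl | ha
  · simp [proj]
  · refine (Padic.norm_sub_le_max _ _).trans (max_le ?_ norm_one.le)
    rw [proj, norm_div, norm_omegaV ha, div_self (norm_ne_zero_iff.mpr ha)]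

lemma Padic.norm_prod_range_add_le {s : ℚ_[p]} (hs : ‖s‖ ≤ 1) (n : ℕ) :
    ‖∏ j ∈ Finset.range n, (s + (j : ℚ_[p]))‖ ≤ ‖(n.factorial : ℚ_[p])‖ := by
  let x : ℤ_[p] := ⟨s, hs⟩
  have h := PadicInt.norm_ascPochhammer_le n x
  have heval : (((ascPochhammer ℤ_[p] n).eval x : ℤ_[p]) : ℚ_[p])
      = ∏ j ∈ Finset.range n, (s + (j : ℚ_[p])) := by
    clear h
    induction n with
    | zero => simp
    | succ n ih =>
      rw [ascPochhammer_succ_eval, PadicInt.coe_mul, PadicInt.coe_add, PadicInt.coe_natCast,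
        ih, Finset.prod_range_succ]
  rwa [PadicInt.norm_def, PadicInt.norm_def, heval, PadicInt.coe_natCast] at h

lemma norm_binom_le_one {s : ℚ_[p]} (hs : ‖s‖ ≤ 1) (n : ℕ) : ‖binom p s n‖ ≤ 1 := by
  have hprod : ‖∏ j ∈ Finset.range n, (s - (j : ℚ_[p]))‖
      = ‖∏ j ∈ Finset.range n, (-s + (j : ℚ_[p]))‖ := by
    rw [norm_prod, norm_prod]
    refine Finset.prod_congr rfl fun j _ => ?_
    rw [← norm_neg]
    congr 1
    ring
  rw [binom, norm_div, hprod]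
  exact div_le_one_of_le₀ (Padic.norm_prod_range_add_le (by rwa [norm_neg]) n) (norm_nonneg _)

lemma norm_hpow_le_one (a : ℚ_[p]) {s : ℚ_[p]} (hs : ‖s‖ ≤ 1) : ‖hpow p a s‖ ≤ 1 := by
  refine IsUltrametricDist.norm_tsum_le_of_forall_le_of_nonneg zero_le_one fun n => ?_
  rw [norm_mul, norm_pow]
  exact mul_le_one₀ (norm_binom_le_one hs n) (by positivity)
    (pow_le_one₀ (norm_nonneg _) (norm_proj_sub_one_le a))

lemma norm_sum_hpow_le_one (a : ℚ_[p]) {s : ℚ_[p]} (hs : ‖s‖ ≤ 1) (N : ℕ) :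
    ‖∑ k ∈ Finset.range N, (-1 : ℚ_[p]) ^ k * hpow p ((k : ℚ_[p]) + a) s‖ ≤ 1 := by
  refine IsUltrametricDist.norm_sum_le_of_forall_le_of_nonneg zero_le_one fun k _ => ?_
  simpa using norm_hpow_le_one ((k : ℚ_[p]) + a) hs

lemma Padic.inv_norm_natCast_le {n : ℕ} (hn : n ≠ 0) : ‖(n : ℚ_[p])‖⁻¹ ≤ n := by
  have hp : 0 < p := (Fact.out : p.Prime).pos
  have hn' : (n : ℚ_[p]) ≠ 0 := mod_cast hn
  rw [Padic.norm_eq_zpow_neg_valuation hn', Padic.valuation_natCast, zpow_neg, inv_inv,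
    zpow_natCast]
  exact mod_cast Nat.le_of_dvd (Nat.pos_of_ne_zero hn) pow_padicValNat_dvd

lemma norm_coeffT_le {s a : ℚ_[p]} (hs : ‖s‖ ≤ 1) (ha : a ≠ 0) (n : ℕ) :
    ‖coeffT p s a (n + 2)‖ ≤ ((n + 2 : ℕ) : ℝ) * ‖a‖⁻¹ ^ (n + 2) := by
  have hprod : ∏ j ∈ Finset.Icc 1 (n + 2 - 1), (s - 1 + (j : ℚ_[p]))
      = ∏ j ∈ Finset.range (n + 1), (s + (j : ℚ_[p])) := by
    rw [← Finset.Ico_add_one_right_eq_Icc, Finset.prod_Ico_eq_prod_range]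
    refine Finset.prod_congr rfl fun j _ => ?_
    push_cast
    ring
  have hfac : ‖((n + 1).factorial : ℚ_[p])‖ ≠ 0 :=
    norm_ne_zero_iff.mpr (mod_cast (n + 1).factorial_ne_zero)
  rw [coeffT, hprod, norm_div, norm_mul, norm_pow, norm_omegaV ha, Nat.factorial_succ (n + 1),
    Nat.cast_mul, norm_mul]
  calc _ ≤ ‖((n + 1).factorial : ℚ_[p])‖ /
        (‖((n + 1 + 1 : ℕ) : ℚ_[p])‖ * ‖((n + 1).factorial : ℚ_[p])‖ * ‖a‖ ^ (n + 2)) := by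
        gcongr
        exact Padic.norm_prod_range_add_le hs (n + 1)
    _ = ‖((n + 2 : ℕ) : ℚ_[p])‖⁻¹ * ‖a‖⁻¹ ^ (n + 2) := by
        rw [inv_pow]
        field_simp
    _ ≤ _ := by
        gcongr
        exact Padic.inv_norm_natCast_le (by omega)

end Auxiliary

/-- Lemma 2 of the paper: for an odd prime `p`, `s ∈ ℤ_p` with `s ≠ 1` and
`a ∈ ℚ_p` with `|a|_p > 1`, the series
`∑_{n≥2} [∏_{j=1}^{n-1}(s-1+j)]/(n! ω_v(a)^n) · (ζ_{p,E}(s+n,a) - ⟨a⟩^{1-(s+n)})`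
converges in `ℚ_p`. -/
theorem padic_hurwitz_euler_series_convergence
    (p : ℕ) [Fact p.Prime] (hodd : p ≠ 2)
    (s : ℚ_[p]) (hs : ‖s‖ ≤ 1) (hs1 : s ≠ 1)
    (a : ℚ_[p]) (ha : 1 < ‖a‖) :
    Summable (fun n : ℕ =>
      coeffT p s a (n + 2) *
        (zetaE p (s + ((n : ℚ_[p]) + 2)) a - hpow p a (1 - (s + ((n : ℚ_[p]) + 2))))) := by
  have ha0 : a ≠ 0 := norm_pos_iff.mp (zero_lt_one.trans ha)
  have hinv : ‖(‖a‖⁻¹ : ℝ)‖ < 1 := by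
    rw [norm_inv, norm_norm]
    exact inv_lt_one_of_one_lt₀ ha
  obtain ⟨C, hC⟩ := exists_forall_norm_limUnder_le (p := p)
  have hexp : ∀ n : ℕ, ‖1 - (s + ((n : ℚ_[p]) + 2))‖ ≤ 1 := fun n => by
    let x : ℤ_[p] := ⟨s, hs⟩
    have hx : ((1 - (x + ((n + 2 : ℕ) : ℤ_[p])) : ℤ_[p]) : ℚ_[p])
        = 1 - (s + ((n : ℚ_[p]) + 2)) := by
      rw [PadicInt.coe_sub, PadicInt.coe_add, PadicInt.coe_natCast, PadicInt.coe_one]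
      push_cast
      rfl
    rw [← hx]
    exact PadicInt.norm_le_one _
  have hsum : Summable fun n : ℕ => ((n : ℕ) : ℝ) * ‖a‖⁻¹ ^ n := by
    simpa using summable_pow_mul_geometric_of_norm_lt_one 1 hinv
  refine Summable.of_norm_bounded (((summable_nat_add_iff 2).mpr hsum).mul_right (max C 1))
    fun n => ?_
  rw [norm_mul]
  refine mul_le_mul (norm_coeffT_le hs ha0 n) ?_ (norm_nonneg _) (by positivity)
  exact (Padic.norm_sub_le_max _ _).trans
    (max_le_max (hC _ fun r => norm_sum_hpow_le_one a (hexp n) (p ^ r))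
      (norm_hpow_le_one a (hexp n)))
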